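/- Assume that every zero of the Riemann zeta function ζ(s) with 0 < Re(s) < 1 has Re(s) = 1/2. Fix ε, ε' ∈ (0, 1/4). Then, as X → ∞, −∫_{(ε')} ∫_{(ε)} ((ζ'/ζ)(1 + α + β))² · Φ̃(1/2 + α) · Φ̃(1/2 + β) · X^{α+β} dα dβ = C_Φ·log X + C'_Φ − 2·γ₀·C_Φ + O(X^{−2/5}), where γ₀ is the Euler–Mascheroni constant. -/

import Mathlib

noncomputable section

open scoped Classical

open Complex Real Filter Asymptotics MeasureTheory

/-- `C_Φ = 4π² ∫₀^∞ Φ(x)² dx`. -/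
def CPhi (Φ : ℝ → ℝ) : ℝ := 4 * π ^ 2 * ∫ x in Set.Ioi (0:ℝ), Φ x ^ 2

/-- `C'_Φ = 4π² ∫₀^∞ (log x) Φ(x)² dx`. -/
def CPhi' (Φ : ℝ → ℝ) : ℝ := 4 * π ^ 2 * ∫ x in Set.Ioi (0:ℝ), Real.log x * Φ x ^ 2

/-- The Mellin transform `Φ̃(s) = ∫₀^∞ Φ(x) x^{s-1} dx` at a complex point `s`. -/
def mellinC (Φ : ℝ → ℝ) (s : ℂ) : ℂ := ∫ x in Set.Ioi (0:ℝ), (Φ x : ℂ) * (x : ℂ) ^ (s - 1)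

/-- The vertical-line integral `∫_{(c)} g(s) ds = i ∫_ℝ g(c + it) dt`. -/
def vertInt (g : ℂ → ℂ) (c : ℝ) : ℂ := Complex.I * ∫ t : ℝ, g ((c : ℂ) + (t : ℂ) * Complex.I)

/-- `n`-th term of the series for `(s - 1) ζ(s) - 1` obtained by comparing `ζ` with an integral. -/
def zetaTerm (n : ℕ) (s : ℂ) : ℂ :=
  (s - 1) * ((n + 1 : ℝ) : ℂ) ^ (-s) + ((n + 2 : ℝ) : ℂ) ^ (1 - s) - ((n + 1 : ℝ) : ℂ) ^ (1 - s)

lemma hasDerivAt_ofReal_add_cpow {a : ℝ} (ha : 0 < a) {u : ℝ} (hu : 0 ≤ u) (w : ℂ) :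
    HasDerivAt (fun v : ℝ => ((a + v : ℝ) : ℂ) ^ w) (w * ((a + u : ℝ) : ℂ) ^ (w - 1)) u := by
  have h1 : HasDerivAt (fun v : ℝ => ((a + v : ℝ) : ℂ)) 1 u := by
    simpa using ((hasDerivAt_id u).const_add a).ofReal_comp
  have h2 : ((a + u : ℝ) : ℂ) ∈ slitPlane := by
    rw [ofReal_mem_slitPlane]; positivity
  simpa [Function.comp_def] using
    ((hasDerivAt_id ((a + u : ℝ) : ℂ)).cpow_const (c := w) h2).comp u h1

lemma norm_zetaTerm_le (n : ℕ) {s : ℂ} (hs : 1 / 2 ≤ s.re) :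
    ‖zetaTerm n s‖ ≤ ‖s‖ * ‖s - 1‖ * (n + 1 : ℝ) ^ (-(3 / 2) : ℝ) := by
  have ha : (0 : ℝ) < n + 1 := by positivity
  have hB : ∀ u : ℝ, 0 ≤ u → ‖((n + 1 + u : ℝ) : ℂ) ^ (-s - 1)‖ ≤ (n + 1 : ℝ) ^ (-(3 / 2) : ℝ) := by
    intro u hu
    rw [norm_cpow_eq_rpow_re_of_pos (by positivity)]
    calc (n + 1 + u : ℝ) ^ (-s - 1).re ≤ (n + 1 + u : ℝ) ^ (-(3 / 2) : ℝ) := by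
          apply Real.rpow_le_rpow_of_exponent_le
          · linarith [(n.cast_nonneg : (0 : ℝ) ≤ n)]
          · simp; linarith
      _ ≤ _ := Real.rpow_le_rpow_of_nonpos ha (by linarith) (by norm_num)
  have h1 : ∀ u ∈ Set.Icc (0 : ℝ) 1,
      ‖((n + 1 : ℝ) : ℂ) ^ (-s) - ((n + 1 + u : ℝ) : ℂ) ^ (-s)‖
        ≤ ‖s‖ * (n + 1 : ℝ) ^ (-(3 / 2) : ℝ) := by
    intro u hu
    have := (convex_Icc (0 : ℝ) u).norm_image_sub_le_of_norm_hasDerivWithin_le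
      (f := fun v : ℝ => ((n + 1 + v : ℝ) : ℂ) ^ (-s))
      (C := ‖s‖ * (n + 1 : ℝ) ^ (-(3 / 2) : ℝ))
      (fun v hv => (hasDerivAt_ofReal_add_cpow ha hv.1 (-s)).hasDerivWithinAt)
      (fun v hv => by
        rw [norm_mul, norm_neg]
        gcongr
        exact hB v hv.1)
      (Set.left_mem_Icc.2 hu.1) (Set.right_mem_Icc.2 hu.1)
    rw [norm_sub_rev]
    refine le_trans (by simpa using this) ?_
    rw [abs_of_nonneg hu.1]
    exact mul_le_of_le_one_right (by positivity) hu.2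
  have h2 := (convex_Icc (0 : ℝ) 1).norm_image_sub_le_of_norm_hasDerivWithin_le
      (f := fun v : ℝ => (s - 1) * ((n + 1 : ℝ) : ℂ) ^ (-s) * v + ((n + 1 + v : ℝ) : ℂ) ^ (1 - s))
      (f' := fun v : ℝ => (s - 1) * ((n + 1 : ℝ) : ℂ) ^ (-s)
        + (1 - s) * ((n + 1 + v : ℝ) : ℂ) ^ (1 - s - 1))
      (C := ‖s‖ * ‖s - 1‖ * (n + 1 : ℝ) ^ (-(3 / 2) : ℝ))
      (fun v hv => by
        have h3 : HasDerivAt (fun v : ℝ => (s - 1) * ((n + 1 : ℝ) : ℂ) ^ (-s) * (v : ℂ))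
            ((s - 1) * ((n + 1 : ℝ) : ℂ) ^ (-s)) v := by
          simpa using (ofRealCLM.hasDerivAt (x := v)).const_mul ((s - 1) * ((n + 1 : ℝ) : ℂ) ^ (-s))
        exact (h3.add (hasDerivAt_ofReal_add_cpow ha hv.1 (1 - s))).hasDerivWithinAt)
      (fun v hv => by
        have : (s - 1) * ((n + 1 : ℝ) : ℂ) ^ (-s) + (1 - s) * ((n + 1 + v : ℝ) : ℂ) ^ (1 - s - 1)
            = (s - 1) * (((n + 1 : ℝ) : ℂ) ^ (-s) - ((n + 1 + v : ℝ) : ℂ) ^ (-s)) := by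
          rw [show 1 - s - 1 = -s by ring]; ring
        rw [this, norm_mul, mul_comm ‖s‖, mul_assoc]
        gcongr
        exact h1 v hv)
      (Set.left_mem_Icc.2 zero_le_one) (Set.right_mem_Icc.2 zero_le_one)
  refine le_trans (le_of_eq ?_) (h2.trans (by simp))
  congr 1
  unfold zetaTerm
  norm_num [add_assoc]

lemma summable_zetaTerm_bound : Summable fun n : ℕ => (n + 1 : ℝ) ^ (-(3 / 2) : ℝ) := by
  have := (Real.summable_nat_rpow (p := -(3 / 2))).2 (by norm_num)
  exact_mod_cast (summable_nat_add_iff 1).2 this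

lemma riemannZeta₁_eq_tsum_of_one_lt_re {s : ℂ} (hs : 1 < s.re) :
    riemannZeta₁ s = 1 + ∑' n, zetaTerm n s := by
  have hs1 : s ≠ 1 := by rintro rfl; simp at hs
  have hsum : HasSum (fun n : ℕ => (s - 1) * ((n + 1 : ℝ) : ℂ) ^ (-s)) ((s - 1) * riemannZeta s) := by
    apply HasSum.mul_left
    have h := (LSeriesHasSum_one hs)
    rw [LSeriesHasSum, ← hasSum_nat_add_iff' 1] at h
    simpa [LSeries.term, cpow_neg, Finset.sum_range_one] using h
  have htel : HasSum (fun n : ℕ => ((n + 2 : ℝ) : ℂ) ^ (1 - s) - ((n + 1 : ℝ) : ℂ) ^ (1 - s))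
      (-1) := by
    have hz : Tendsto (fun n : ℕ => ((n + 1 : ℝ) : ℂ) ^ (1 - s)) atTop (nhds 0) := by
      rw [tendsto_zero_iff_norm_tendsto_zero]
      have : Tendsto (fun n : ℕ => ((n : ℝ) + 1) ^ (-(s.re - 1))) atTop (nhds 0) :=
        (tendsto_rpow_neg_atTop (by linarith)).comp
          (tendsto_atTop_add_const_right _ _ tendsto_natCast_atTop_atTop)
      refine this.congr fun n => ?_
      rw [norm_cpow_eq_rpow_re_of_pos (by positivity)]
      simp
    have hs2 : Summable (fun n : ℕ => ((n + 2 : ℝ) : ℂ) ^ (1 - s) - ((n + 1 : ℝ) : ℂ) ^ (1 - s)) := by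
      have h3 : Summable (fun n : ℕ => zetaTerm n s) :=
        Summable.of_norm_bounded (summable_zetaTerm_bound.mul_left (‖s‖ * ‖s - 1‖))
          (fun n => norm_zetaTerm_le n (by linarith))
      refine (h3.sub hsum.summable).congr fun n => ?_
      unfold zetaTerm; ring
    have h4 := hs2.hasSum.tendsto_sum_nat
    have h5 : Tendsto (fun n : ℕ => ∑ i ∈ Finset.range n,
        (((i + 2 : ℝ) : ℂ) ^ (1 - s) - ((i + 1 : ℝ) : ℂ) ^ (1 - s))) atTop (nhds (0 - 1)) := by
      refine (hz.sub_const 1).congr fun n => ?_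
      have := Finset.sum_range_sub (fun i : ℕ => ((i + 1 : ℝ) : ℂ) ^ (1 - s)) n
      simp at this ⊢
      rw [← Finset.sum_sub_distrib] at *
      rw [← this]
      refine Finset.sum_congr rfl fun i _ => ?_
      rw [add_assoc]; norm_num
    have h6 := hs2.hasSum
    rwa [tendsto_nhds_unique h4 h5, zero_sub] at h6
  have h := hsum.add htel
  have h6 : (fun n : ℕ => zetaTerm n s) = fun n : ℕ => (s - 1) * ((n + 1 : ℝ) : ℂ) ^ (-s) +
      (((n + 2 : ℝ) : ℂ) ^ (1 - s) - ((n + 1 : ℝ) : ℂ) ^ (1 - s)) := by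
    ext n; unfold zetaTerm; ring
  rw [h6, h.tsum_eq, riemannZeta_eq_inv_sub_mul hs1]
  have := sub_ne_zero.2 hs1
  field_simp
  ring

lemma riemannZeta₁_eq_tsum {s : ℂ} (hs : 1 / 2 < s.re) :
    riemannZeta₁ s = 1 + ∑' n, zetaTerm n s := by
  have hopen : IsOpen {z : ℂ | 1 / 2 < z.re} := isOpen_lt continuous_const continuous_re
  have hd : DifferentiableOn ℂ (fun z => 1 + ∑' n, zetaTerm n z) {z : ℂ | 1 / 2 < z.re} := by
    intro z hz
    have hU : IsOpen ({w : ℂ | 1 / 2 < w.re} ∩ Metric.ball 0 (‖z‖ + 1)) :=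
      hopen.inter Metric.isOpen_ball
    have hzU : z ∈ ({w : ℂ | 1 / 2 < w.re} ∩ Metric.ball 0 (‖z‖ + 1)) :=
      ⟨hz, by simp⟩
    have := differentiableOn_tsum_of_summable_norm (F := zetaTerm)
      (summable_zetaTerm_bound.mul_left ((‖z‖ + 1) * (‖z‖ + 2)))
      (fun n => by
        have h1 : ((n + 1 : ℝ) : ℂ) ≠ 0 := by exact_mod_cast n.succ_ne_zero
        have h2 : ((n + 2 : ℝ) : ℂ) ≠ 0 := by exact_mod_cast (n + 1).succ_ne_zero
        have : Differentiable ℂ (zetaTerm n) := by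
          unfold zetaTerm
          exact (((differentiable_id.sub_const 1).mul (differentiable_id.neg.const_cpow (Or.inl h1))).add
            ((differentiable_id.const_sub 1).const_cpow (Or.inl h2))).sub
            ((differentiable_id.const_sub 1).const_cpow (Or.inl h1))
        exact this.differentiableOn) hU
      (fun n w hw => by
        refine (norm_zetaTerm_le n (le_of_lt hw.1)).trans ?_
        have h1 : ‖w‖ ≤ ‖z‖ + 1 := le_of_lt (by simpa using hw.2)
        have h2 : ‖w - 1‖ ≤ ‖z‖ + 2 := by
          have := norm_sub_le w 1
          simp at this; linarith
        gcongr)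
    exact ((this.differentiableAt (hU.mem_nhds hzU)).const_add 1).differentiableWithinAt
  have hconv : Convex ℝ {z : ℂ | 1 / 2 < z.re} := convex_halfSpace_re_gt _
  have h2 : (2 : ℂ) ∈ {z : ℂ | 1 / 2 < z.re} := by simp; norm_num
  refine (differentiable_riemannZeta₁.differentiableOn.analyticOnNhd hopen).eqOn_of_preconnected_of_eventuallyEq
    (hd.analyticOnNhd hopen) hconv.isPreconnected h2 ?_ hs
  have : {z : ℂ | 1 < z.re} ∈ nhds (2 : ℂ) :=
    (isOpen_lt continuous_const continuous_re).mem_nhds (by simp)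
  filter_upwards [this] with z hz
  exact riemannZeta₁_eq_tsum_of_one_lt_re hz

lemma exists_norm_riemannZeta₁_le :
    ∃ C : ℝ, 0 < C ∧ ∀ s : ℂ, 1 / 2 < s.re → ‖riemannZeta₁ s‖ ≤ C * (1 + ‖s‖) ^ 2 := by
  set S := ∑' n : ℕ, (n + 1 : ℝ) ^ (-(3 / 2) : ℝ) with hS
  have hS0 : 0 ≤ S := tsum_nonneg fun n => by positivity
  refine ⟨1 + S, by positivity, fun s hs => ?_⟩
  rw [riemannZeta₁_eq_tsum hs]
  have h1 : ‖∑' n, zetaTerm n s‖ ≤ ‖s‖ * ‖s - 1‖ * S := by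
    have := tsum_of_norm_bounded ((summable_zetaTerm_bound.hasSum).mul_left (‖s‖ * ‖s - 1‖))
      (fun n => norm_zetaTerm_le n hs.le)
    exact this
  have h2 : ‖s - 1‖ ≤ ‖s‖ + 1 := by simpa using norm_sub_le s 1
  have h3 : ‖s‖ * ‖s - 1‖ * S ≤ (1 + ‖s‖) * (1 + ‖s‖) * S := by
    gcongr <;> linarith [norm_nonneg s]
  calc _ ≤ ‖(1 : ℂ)‖ + ‖∑' n, zetaTerm n s‖ := norm_add_le _ _
    _ ≤ 1 + (1 + ‖s‖) * (1 + ‖s‖) * S := by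
      rw [norm_one]; linarith
    _ ≤ _ := by nlinarith [norm_nonneg s]

lemma exists_le_norm_riemannZeta₁_two_add :
    ∃ c : ℝ, 0 < c ∧ ∀ s : ℂ, s.re = 2 → c ≤ ‖riemannZeta₁ s‖ := by
  refine ⟨2 - π ^ 2 / 6, by nlinarith [Real.pi_lt_d2, Real.pi_pos], fun s hs => ?_⟩
  have hs1 : s ≠ 1 := by rintro rfl; norm_num at hs
  have hz : ‖riemannZeta s - 1‖ ≤ π ^ 2 / 6 - 1 := by
    have h := (LSeriesHasSum_one (s := s) (by linarith))
    rw [LSeriesHasSum, ← hasSum_nat_add_iff' 2] at h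
    have h2 := (hasSum_nat_add_iff' 2).2 hasSum_zeta_two
    simp [Finset.sum_range_succ, LSeries.term] at h h2
    rw [← h.tsum_eq]
    refine tsum_of_norm_bounded h2 fun n => ?_
    have : ((n : ℂ) + 2) = ((n + 2 : ℝ) : ℂ) := by push_cast; rfl
    rw [norm_inv, this, norm_cpow_eq_rpow_re_of_pos (by positivity), hs]
    simp
  have h1 : 2 - π ^ 2 / 6 ≤ ‖riemannZeta s‖ := by
    have := norm_sub_norm_le (1 : ℂ) (1 - riemannZeta s)
    rw [norm_sub_rev 1 (riemannZeta s)] at this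
    simp at this
    linarith
  have h2 : riemannZeta₁ s = (s - 1) * riemannZeta s := by
    rw [riemannZeta_eq_inv_sub_mul hs1]
    have := sub_ne_zero.2 hs1
    field_simp
  have h3 : 1 ≤ ‖s - 1‖ := by
    have := abs_re_le_norm (s - 1)
    simp [hs] at this
    norm_num at this
    exact this
  rw [h2, norm_mul]
  nlinarith [norm_nonneg (riemannZeta s)]

/-- A holomorphic function without zeros that is at most `K` times its value at the centre of a ball
has logarithmic derivative `O(log K)` well inside the ball. -/
lemma norm_logDeriv_le_of_norm_le_mul {f : ℂ → ℂ} {c z : ℂ} {r R K : ℝ} (hr : 0 < r) (hrR : r < R)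
    (hK : 1 < K) (hf : DifferentiableOn ℂ f (Metric.ball c R))
    (h0 : ∀ w ∈ Metric.ball c R, f w ≠ 0) (hb : ∀ w ∈ Metric.ball c R, ‖f w‖ ≤ K * ‖f c‖)
    (hz : z ∈ Metric.closedBall c r) :
    ‖logDeriv f z‖ ≤ 8 * R * Real.log K / (R - r) ^ 2 := by
  have hR : 0 < R := hr.trans hrR
  have hM : 0 < Real.log K := Real.log_pos hK
  have hc : c ∈ Metric.ball c R := Metric.mem_ball_self hR
  have hfd : ∀ w ∈ Metric.ball c R, HasDerivAt f (deriv f w) w := fun w hw =>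
    (hf.differentiableAt (Metric.isOpen_ball.mem_nhds hw)).hasDerivAt
  have hL : DifferentiableOn ℂ (logDeriv f) (Metric.ball c R) :=
    (hf.deriv Metric.isOpen_ball).div hf h0
  obtain ⟨g, hg0, hg⟩ := hL.isExactOn_ball.with_val_at c 0
  have hexp : ∀ w ∈ Metric.ball c R, f w = f c * cexp (g w) := by
    have hder : ∀ w ∈ Metric.ball c R, HasDerivAt (fun w => f w * cexp (-g w)) 0 w := by
      intro w hw
      have h := (hfd w hw).fun_mul ((hg w hw).fun_neg.cexp)
      refine h.congr_deriv ?_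
      have := h0 w hw
      rw [logDeriv_apply]
      field_simp
      ring
    intro w hw
    have := (convex_ball c R).is_const_of_fderivWithin_eq_zero (𝕜 := ℂ)
      (f := fun w => f w * cexp (-g w))
      (fun w hw => (hder w hw).differentiableAt.differentiableWithinAt)
      (fun w hw => by
        rw [fderivWithin_of_isOpen Metric.isOpen_ball hw]
        ext; simp [(hder w hw).deriv]) hw hc
    simp only [hg0, neg_zero, Complex.exp_zero, mul_one] at this
    rw [← this, mul_assoc, ← Complex.exp_add]
    simp
  have hre : ∀ w ∈ Metric.ball c R, (g w).re ≤ Real.log K := by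
    intro w hw
    have h1 := hb w hw
    rw [hexp w hw, norm_mul, Complex.norm_exp, mul_comm] at h1
    have h2 := le_of_mul_le_mul_right h1 (norm_pos_iff.2 (h0 c hc))
    exact (Real.le_log_iff_exp_le (by linarith)).2 h2
  have hbc : ∀ w ∈ Metric.closedBall c ((r + R) / 2), ‖g w‖ ≤ 4 * R * Real.log K / (R - r) := by
    intro w hw
    rw [mem_closedBall_iff_norm] at hw
    have hmaps : ∀ v ∈ Metric.ball (0 : ℂ) R, c + v ∈ Metric.ball c R := by
      intro v hv; simpa using hv
    have h := borelCaratheodory_zero (f := fun v => g (c + v)) (z := w - c) (R := R) hM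
      (fun v hv => by
        have := ((hg _ (hmaps v hv)).comp_const_add c v).differentiableAt
        exact this.differentiableWithinAt)
      (fun v hv => hre _ (hmaps v hv)) hR
      (by rw [mem_ball_zero_iff]; linarith) (by simpa using hg0)
    simp only [add_sub_cancel] at h
    refine h.trans ?_
    rw [div_le_div_iff₀ (by linarith) (by linarith)]
    have : ‖w - c‖ * (R - r) ≤ R * (2 * (R - ‖w - c‖)) := by
      nlinarith [norm_nonneg (w - c)]
    nlinarith
  have hsub : Metric.closedBall z ((R - r) / 2) ⊆ Metric.closedBall c ((r + R) / 2) := by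
    apply Metric.closedBall_subset_closedBall'
    rw [Metric.mem_closedBall] at hz
    linarith
  have hsub2 : Metric.closedBall c ((r + R) / 2) ⊆ Metric.ball c R :=
    Metric.closedBall_subset_ball (by linarith)
  have hzR : z ∈ Metric.ball c R :=
    hsub2 (hsub (Metric.mem_closedBall_self (by linarith)))
  have hcau := norm_deriv_le_of_forall_mem_sphere_norm_le (c := z) (R := (R - r) / 2)
    (C := 4 * R * Real.log K / (R - r)) (f := g) (by linarith)
    (DifferentiableOn.diffContOnCl_ball (U := Metric.ball c R)
      (fun w hw => (hg w hw).differentiableAt.differentiableWithinAt) (hsub.trans hsub2))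
    (fun w hw => hbc w (hsub (Metric.sphere_subset_closedBall hw)))
  rw [(hg z hzR).deriv] at hcau
  refine hcau.trans (le_of_eq ?_)
  have : R - r ≠ 0 := by linarith
  field_simp
  ring

lemma riemannZeta₁_ne_zero
    (hRH : ∀ s : ℂ, 0 < s.re → s.re < 1 → riemannZeta s = 0 → s.re = 1 / 2)
    {s : ℂ} (hs : 1 / 2 < s.re) : riemannZeta₁ s ≠ 0 := by
  by_cases hs1 : s = 1
  · simp [hs1]
  intro h
  have hz : riemannZeta s = 0 := by rw [riemannZeta_eq_inv_sub_mul hs1, h, mul_zero]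
  rcases lt_or_ge s.re 1 with h1 | h1
  · linarith [hRH s (by linarith) h1 hz]
  · exact riemannZeta_ne_zero_of_one_le_re h1 hz

lemma exists_norm_logDeriv_riemannZeta₁_le
    (hRH : ∀ s : ℂ, 0 < s.re → s.re < 1 → riemannZeta s = 0 → s.re = 1 / 2) :
    ∃ C : ℝ, 0 < C ∧ ∀ s : ℂ, 3 / 5 ≤ s.re → s.re ≤ 3 / 2 →
      ‖logDeriv riemannZeta₁ s‖ ≤ C * (1 + s.im ^ 2) := by
  obtain ⟨A, hA, hAb⟩ := exists_norm_riemannZeta₁_le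
  obtain ⟨c, hc, hcb⟩ := exists_le_norm_riemannZeta₁_two_add
  refine ⟨8 * (29 / 20) * (A * 30 / c + 1) / (29 / 20 - 7 / 5) ^ 2, by positivity,
    fun s h1 h2 => ?_⟩
  set t := s.im with ht
  set c0 : ℂ := 2 + t * I with hc0
  have hc0re : c0.re = 2 := by simp [hc0]
  set K : ℝ := A * (5 + |t|) ^ 2 / c + 1 with hK
  have hK1 : 1 < K := by rw [hK]; have : 0 < A * (5 + |t|) ^ 2 / c := by positivity
                         linarith
  have hball : ∀ w ∈ Metric.ball c0 (29 / 20), 1 / 2 < w.re := by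
    intro w hw
    rw [mem_ball_iff_norm] at hw
    have := (abs_re_le_norm (w - c0)).trans_lt hw
    rw [sub_re, hc0re, abs_lt] at this
    linarith
  have hz : s ∈ Metric.closedBall c0 (7 / 5) := by
    rw [mem_closedBall_iff_norm]
    have : s - c0 = ((s.re - 2 : ℝ) : ℂ) := by
      apply Complex.ext <;> simp [hc0, ht]
    rw [this, norm_real, Real.norm_eq_abs, abs_le]
    constructor <;> linarith
  have h := norm_logDeriv_le_of_norm_le_mul (f := riemannZeta₁) (by norm_num) (by norm_num) hK1
    differentiable_riemannZeta₁.differentiableOn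
    (fun w hw => riemannZeta₁_ne_zero hRH (hball w hw))
    (fun w hw => by
      have hw' : ‖w‖ ≤ 4 + |t| := by
        rw [mem_ball_iff_norm] at hw
        have h3 : ‖c0‖ ≤ 2 + |t| := by
          refine (norm_add_le _ _).trans ?_
          simp
        have := norm_sub_norm_le w c0
        linarith
      calc ‖riemannZeta₁ w‖ ≤ A * (1 + ‖w‖) ^ 2 := hAb w (hball w hw)
        _ ≤ A * (5 + |t|) ^ 2 :=
            mul_le_mul_of_nonneg_left
              (pow_le_pow_left₀ (by positivity) (by linarith) 2) hA.le
        _ = A * (5 + |t|) ^ 2 / c * c := by field_simp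
        _ ≤ K * ‖riemannZeta₁ c0‖ := by
            gcongr
            · rw [hK]; linarith
            · exact hcb c0 hc0re) hz
  refine h.trans ?_
  have hlog : Real.log K ≤ (A * 30 / c + 1) * (1 + t ^ 2) := by
    have h3 : Real.log K ≤ A * (5 + |t|) ^ 2 / c := by
      have := Real.log_le_sub_one_of_pos (show 0 < K by linarith)
      rw [hK] at this ⊢; linarith
    have h4 : (5 + |t|) ^ 2 ≤ 30 * (1 + t ^ 2) := by
      nlinarith [sq_abs t, sq_nonneg (|t| - 1)]
    calc _ ≤ A * (5 + |t|) ^ 2 / c := h3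
      _ ≤ A * (30 * (1 + t ^ 2)) / c := by gcongr
      _ = A * 30 / c * (1 + t ^ 2) := by ring
      _ ≤ _ := by gcongr; linarith
  calc _ ≤ 8 * (29 / 20) * ((A * 30 / c + 1) * (1 + t ^ 2)) / (29 / 20 - 7 / 5) ^ 2 := by gcongr
    _ = _ := by ring

/-- Under the Riemann hypothesis, `(ζ'/ζ)²` minus its polar part at `1` is holomorphic and of
polynomial growth to the right of the critical line. -/
lemma exists_regularPart_logDeriv_riemannZeta_sq
    (hRH : ∀ s : ℂ, 0 < s.re → s.re < 1 → riemannZeta s = 0 → s.re = 1 / 2) :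
    ∃ H : ℂ → ℂ, ∃ C : ℝ, 0 < C ∧ DifferentiableOn ℂ H {s | 1 / 2 < s.re} ∧
      (∀ s : ℂ, 1 / 2 < s.re → s ≠ 1 → (deriv riemannZeta s / riemannZeta s) ^ 2 =
        H s + (1 / (s - 1) ^ 2 - 2 * Real.eulerMascheroniConstant / (s - 1))) ∧
      ∀ s : ℂ, 3 / 5 ≤ s.re → s.re ≤ 3 / 2 → ‖H s‖ ≤ C * (1 + s.im ^ 2) ^ 2 := by
  obtain ⟨C, hC, hCb⟩ := exists_norm_logDeriv_riemannZeta₁_le hRH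
  have hopen : IsOpen {s : ℂ | 1 / 2 < s.re} := isOpen_lt continuous_const continuous_re
  set L := logDeriv riemannZeta₁ with hL
  have hLd : DifferentiableOn ℂ L {s | 1 / 2 < s.re} :=
    differentiable_riemannZeta₁.deriv.differentiableOn.div
      differentiable_riemannZeta₁.differentiableOn fun s hs => riemannZeta₁_ne_zero hRH hs
  have hL1 : L 1 = Real.eulerMascheroniConstant := by simp [hL, logDeriv_apply]
  have hDd : DifferentiableOn ℂ (dslope L 1) {s | 1 / 2 < s.re} :=
    (differentiableOn_dslope (hopen.mem_nhds (by simp; norm_num))).2 hLd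
  have hcpt : IsCompact ({s : ℂ | 3 / 5 ≤ s.re ∧ s.re ≤ 3 / 2} ∩ {s | |s.im| ≤ 1}) := by
    have : {s : ℂ | 3 / 5 ≤ s.re ∧ s.re ≤ 3 / 2} ∩ {s | |s.im| ≤ 1} =
        Set.Icc (3 / 5 : ℝ) (3 / 2) ×ℂ Set.Icc (-1 : ℝ) 1 := by
      ext s; simp [mem_reProdIm, abs_le]
    rw [this]
    exact isCompact_Icc.reProdIm isCompact_Icc
  obtain ⟨B, hB⟩ := hcpt.exists_bound_of_continuousOn
    (hDd.continuousOn.mono fun s hs => by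
      have := hs.1.1
      simp only [Set.mem_ofPred_eq] at this ⊢; linarith)
  have hslope : ∀ s : ℂ, s ≠ 1 → dslope L 1 s = (L s - Real.eulerMascheroniConstant) / (s - 1) := by
    intro s hs
    rw [dslope_of_ne _ hs, slope_def_field, hL1]
  refine ⟨fun s => L s ^ 2 - 2 * dslope L 1 s,
    C ^ 2 + 2 * (|B| + C + |Real.eulerMascheroniConstant|), by positivity,
    (hLd.pow 2).sub (hDd.const_mul 2), fun s hs hs1 => ?_, fun s h1 h2 => ?_⟩
  · have hs' := sub_ne_zero.2 hs1
    have hz := riemannZeta₁_ne_zero hRH hs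
    have h3 : deriv riemannZeta s / riemannZeta s = L s - 1 / (s - 1) := by
      rw [deriv_riemannZeta_eq_neg_inv_sub_sq_mul_add hs1, riemannZeta_eq_inv_sub_mul hs1, hL,
        logDeriv_apply]
      field_simp
      ring
    rw [h3]
    simp only [hslope s hs1]
    field_simp
    ring
  · have hD : ‖dslope L 1 s‖ ≤ (|B| + C + |Real.eulerMascheroniConstant|) * (1 + s.im ^ 2) := by
      rcases le_or_gt |s.im| 1 with h | h
      · have h3 := hB s ⟨⟨h1, h2⟩, h⟩
        nlinarith [le_abs_self B, abs_nonneg B, abs_nonneg Real.eulerMascheroniConstant,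
          mul_nonneg (show 0 ≤ |B| + C + |Real.eulerMascheroniConstant| by positivity)
            (sq_nonneg s.im)]
      · have hs1 : s ≠ 1 := by rintro rfl; simp at h; linarith
        rw [hslope s hs1, norm_div]
        have h3 : 1 ≤ ‖s - 1‖ := by
          have := abs_im_le_norm (s - 1)
          simp at this; linarith
        have h4 := (norm_sub_le (L s) Real.eulerMascheroniConstant).trans
          (add_le_add_left (hCb s h1 h2) _)
        rw [norm_real, Real.norm_eq_abs] at h4
        refine (div_le_self (norm_nonneg _) h3).trans (h4.trans ?_)
        nlinarith [abs_nonneg B, abs_nonneg Real.eulerMascheroniConstant, sq_nonneg s.im,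
          mul_nonneg (abs_nonneg B) (sq_nonneg s.im),
          mul_nonneg (abs_nonneg Real.eulerMascheroniConstant) (sq_nonneg s.im)]
    have hLb : ‖L s ^ 2‖ ≤ (C * (1 + s.im ^ 2)) ^ 2 := by
      rw [norm_pow]
      exact pow_le_pow_left₀ (norm_nonneg _) (hCb s h1 h2) 2
    refine (norm_sub_le _ _).trans ?_
    rw [norm_mul, Complex.norm_ofNat]
    set E := |B| + C + |Real.eulerMascheroniConstant|
    have hE : 0 ≤ E := by positivity
    nlinarith [sq_nonneg s.im, mul_nonneg hE (sq_nonneg s.im),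
      mul_nonneg hE (sq_nonneg (s.im ^ 2))]

section Mellin

variable {f : ℝ → ℂ}

lemma HasCompactSupport.eventuallyEq_zero_atTop (hc : HasCompactSupport f) :
    f =ᶠ[atTop] fun _ => (0 : ℂ) :=
  (hasCompactSupport_iff_eventuallyEq.1 hc).filter_mono (by
    rw [coclosedCompact_eq_cocompact]; exact atTop_le_cocompact)

lemma HasCompactSupport.isBigO_rpow_atTop (hc : HasCompactSupport f) (a : ℝ) :
    f =O[atTop] fun x : ℝ => x ^ (-a) :=
  hc.eventuallyEq_zero_atTop.trans_isBigO (isBigO_zero _ _)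

lemma Continuous.isBigO_rpow_zero (hf : Continuous f) :
    f =O[nhdsWithin 0 (Set.Ioi 0)] fun x : ℝ => x ^ (-(0 : ℝ)) := by
  simp only [neg_zero, Real.rpow_zero]
  exact (hf.continuousAt.isBigO_one ℝ).mono nhdsWithin_le_nhds

lemma Continuous.mellinConvergent_of_hasCompactSupport (hf : Continuous f)
    (hc : HasCompactSupport f) {s : ℂ} (hs : 0 < s.re) : MellinConvergent f s :=
  mellinConvergent_of_isBigO_rpow (a := s.re + 1) (b := 0)
    (hf.locallyIntegrable.locallyIntegrableOn _) (hc.isBigO_rpow_atTop _) (by linarith)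
    hf.isBigO_rpow_zero hs

lemma Continuous.differentiableAt_mellin_of_hasCompactSupport (hf : Continuous f)
    (hc : HasCompactSupport f) {s : ℂ} (hs : 0 < s.re) : DifferentiableAt ℂ (mellin f) s :=
  mellin_differentiableAt_of_isBigO_rpow (a := s.re + 1) (b := 0)
    (hf.locallyIntegrable.locallyIntegrableOn _) (hc.isBigO_rpow_atTop _) (by linarith)
    hf.isBigO_rpow_zero hs

lemma mul_mellin_eq_neg_mellin_mul_deriv (hf : ContDiff ℝ (⊤ : ℕ∞) f) (hc : HasCompactSupport f)
    {s : ℂ} (hs : 0 < s.re) :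
    s * mellin f s = -mellin (fun x : ℝ => (x : ℂ) * deriv f x) s := by
  have hs0 : s ≠ 0 := by rintro rfl; simp at hs
  have hd : Continuous (deriv f) := hf.continuous_deriv (by simp)
  have hθ : Continuous fun x : ℝ => (x : ℂ) * deriv f x := by fun_prop
  have hθc : HasCompactSupport fun x : ℝ => (x : ℂ) * deriv f x := hc.deriv.mul_left
  have h1 := hf.continuous.mellinConvergent_of_hasCompactSupport hc hs
  have h2 := hθ.mellinConvergent_of_hasCompactSupport hθc hs
  simp only [MellinConvergent, smul_eq_mul] at h1 h2
  have hI := (h1.const_mul s).add h2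
  have hder : ∀ x ∈ Set.Ioi (0 : ℝ), HasDerivAt (fun x : ℝ => (x : ℂ) ^ s * f x)
      (s * ((x : ℂ) ^ (s - 1) * f x) + (x : ℂ) ^ (s - 1) * ((x : ℂ) * deriv f x)) x := by
    intro x hx
    have hx0 : (x : ℂ) ≠ 0 := by exact_mod_cast (ne_of_gt hx)
    have h3 : HasDerivAt (fun y : ℝ => (y : ℂ) ^ s) (s * (x : ℂ) ^ (s - 1)) x := by
      simpa [Function.comp_def] using
        ((hasDerivAt_id ((x : ℝ) : ℂ)).cpow_const (c := s) (by
          rw [id, ofReal_mem_slitPlane]; exact hx)).comp x (ofRealCLM.hasDerivAt (x := x))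
    refine (h3.mul ((hf.differentiable (by simp)) x).hasDerivAt).congr_deriv ?_
    rw [cpow_sub _ _ hx0, cpow_one]
    field_simp
  have hkey := integral_Ioi_of_hasDerivAt_of_tendsto (m := 0)
    (f := fun x : ℝ => (x : ℂ) ^ s * f x)
    (((continuousAt_ofReal_cpow_const 0 s (Or.inl hs)).mul
      hf.continuous.continuousAt).continuousWithinAt) hder hI (by
      have h : (fun x : ℝ => (x : ℂ) ^ s * f x) =ᶠ[atTop] fun _ => (0 : ℂ) := by
        filter_upwards [hc.eventuallyEq_zero_atTop] with x hx
        simp [hx]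
      exact tendsto_const_nhds.congr' h.symm)
  rw [integral_add (h1.const_mul s) h2, integral_const_mul] at hkey
  simp only [ofReal_zero, zero_cpow hs0, zero_mul, sub_zero] at hkey
  simp only [mellin, smul_eq_mul]
  exact eq_neg_of_add_eq_zero_left hkey

lemma exists_norm_pow_mul_norm_mellin_le {a b : ℝ} (ha : 0 < a) (k : ℕ) :
    ∀ {f : ℝ → ℂ}, ContDiff ℝ (⊤ : ℕ∞) f → HasCompactSupport f →
      ∃ C : ℝ, ∀ s : ℂ, a ≤ s.re → s.re ≤ b → ‖s‖ ^ k * ‖mellin f s‖ ≤ C := by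
  induction k with
  | zero =>
    intro f hf hc
    by_cases hab : a ≤ b
    swap
    · exact ⟨0, fun s h1 h2 => absurd (h1.trans h2) hab⟩
    have hA := (hf.continuous.mellinConvergent_of_hasCompactSupport hc (s := a) (by simpa)).norm
    have hB := (hf.continuous.mellinConvergent_of_hasCompactSupport hc (s := b)
      (by simpa using ha.trans_le hab)).norm
    refine ⟨∫ x in Set.Ioi (0 : ℝ), (‖(x : ℂ) ^ ((a : ℂ) - 1) • f x‖ +
      ‖(x : ℂ) ^ ((b : ℂ) - 1) • f x‖), fun s h1 h2 => ?_⟩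
    rw [pow_zero, one_mul, mellin]
    refine norm_integral_le_of_norm_le (hA.add hB) ?_
    filter_upwards [ae_restrict_mem measurableSet_Ioi] with x hx
    have hx0 : (0 : ℝ) < x := hx
    simp only [norm_smul, norm_cpow_eq_rpow_re_of_pos hx0, sub_re, ofReal_re, one_re]
    rw [← add_mul]
    gcongr
    rcases le_total 1 x with h | h
    · exact (Real.rpow_le_rpow_of_exponent_le h (by linarith)).trans
        (le_add_of_nonneg_left (by positivity))
    · exact (Real.rpow_le_rpow_of_exponent_ge hx0 h (by linarith)).trans
        (le_add_of_nonneg_right (by positivity))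
  | succ k ih =>
    intro f hf hc
    have hd : ContDiff ℝ (⊤ : ℕ∞) (deriv f) := (contDiff_infty_iff_deriv.1 hf).2
    obtain ⟨C, hC⟩ := ih (f := fun x : ℝ => (x : ℂ) * deriv f x)
      (ofRealCLM.contDiff.mul hd) hc.deriv.mul_left
    refine ⟨C, fun s h1 h2 => ?_⟩
    refine le_trans (le_of_eq ?_) (hC s h1 h2)
    rw [pow_succ, mul_assoc, ← norm_mul,
      mul_mellin_eq_neg_mellin_mul_deriv hf hc (ha.trans_le h1), norm_neg]

lemma exists_norm_mellin_le {a b : ℝ} (ha : 0 < a) (hf : ContDiff ℝ (⊤ : ℕ∞) f)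
    (hc : HasCompactSupport f) :
    ∃ C : ℝ, 0 < C ∧ ∀ s : ℂ, a ≤ s.re → s.re ≤ b →
      ‖mellin f s‖ ≤ C * ((1 + s.im ^ 2) ^ 3)⁻¹ := by
  obtain ⟨C0, h0⟩ := exists_norm_pow_mul_norm_mellin_le (b := b) ha 0 hf hc
  obtain ⟨C6, h6⟩ := exists_norm_pow_mul_norm_mellin_le (b := b) ha 6 hf hc
  refine ⟨4 * (|C0| + |C6|) + 1, by positivity, fun s h1 h2 => ?_⟩
  have hs0 := h0 s h1 h2
  have hs6 := h6 s h1 h2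
  have him : s.im ^ 2 ≤ ‖s‖ ^ 2 := by
    have := abs_im_le_norm s
    exact sq_le_sq' (by linarith [neg_abs_le s.im]) ((le_abs_self _).trans this)
  have h3 : (1 + s.im ^ 2) ^ 3 ≤ 4 * (1 + ‖s‖ ^ 6) := by
    have : (1 + s.im ^ 2) ^ 3 ≤ (1 + ‖s‖ ^ 2) ^ 3 := by gcongr
    nlinarith [mul_nonneg (show 0 ≤ 1 + ‖s‖ ^ 2 by positivity) (sq_nonneg (1 - ‖s‖ ^ 2))]
  rw [← div_eq_mul_inv, le_div_iff₀ (by positivity)]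
  calc ‖mellin f s‖ * (1 + s.im ^ 2) ^ 3 ≤ ‖mellin f s‖ * (4 * (1 + ‖s‖ ^ 6)) := by gcongr
    _ = 4 * (‖s‖ ^ 0 * ‖mellin f s‖ + ‖s‖ ^ 6 * ‖mellin f s‖) := by ring
    _ ≤ 4 * (C0 + C6) := by gcongr
    _ ≤ _ := by linarith [le_abs_self C0, le_abs_self C6]

lemma continuous_mellin_vertical (hf : Continuous f) (hc : HasCompactSupport f) {σ : ℝ}
    (hσ : 0 < σ) : Continuous fun t : ℝ => mellin f (σ + t * I) := by
  rw [continuous_iff_continuousAt]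
  intro t
  have h := (hf.differentiableAt_mellin_of_hasCompactSupport hc (s := σ + t * I)
    (by simpa using hσ)).continuousAt
  exact ContinuousAt.comp (f := fun t : ℝ => (σ + t * I : ℂ)) h (by fun_prop)

lemma integrable_mellin_vertical (hf : ContDiff ℝ (⊤ : ℕ∞) f) (hc : HasCompactSupport f) {σ : ℝ}
    (hσ : 0 < σ) : Integrable fun t : ℝ => mellin f (σ + t * I) := by
  obtain ⟨C, hC, h⟩ := exists_norm_mellin_le (b := σ) hσ hf hc
  refine (integrable_inv_one_add_sq.const_mul C).mono'
    (continuous_mellin_vertical hf.continuous hc hσ).aestronglyMeasurable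
    (ae_of_all _ fun t => ?_)
  refine (h _ (by simp) (by simp)).trans ?_
  have : (σ + t * I : ℂ).im = t := by simp
  rw [this]
  gcongr
  exact le_self_pow₀ (by nlinarith [sq_nonneg t]) (by norm_num)

lemma integral_cpow_mul_mellin (hf : ContDiff ℝ (⊤ : ℕ∞) f) (hc : HasCompactSupport f) {σ x : ℝ}
    (hσ : 0 < σ) (hx : 0 < x) :
    ∫ t : ℝ, (x : ℂ) ^ (-(σ + t * I : ℂ)) * mellin f (σ + t * I) = 2 * π * f x := by
  have h := mellinInv_mellin_eq σ f hx
    (hf.continuous.mellinConvergent_of_hasCompactSupport hc (by simpa using hσ))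
    (integrable_mellin_vertical hf hc hσ) hf.continuous.continuousAt
  rw [← h, mellinInv]
  have hpi : (π : ℂ) ≠ 0 := by exact_mod_cast pi_ne_zero
  simp only [smul_eq_mul, real_smul]
  push_cast
  rw [← mul_assoc, mul_one_div_cancel (mul_ne_zero two_ne_zero hpi), one_mul]

/-- Parseval's formula for the Mellin transform along a vertical line. -/
lemma integral_integral_cpow_mul_mellin (hf : ContDiff ℝ (⊤ : ℕ∞) f) (hc : HasCompactSupport f)
    {σ : ℝ} (hσ : 0 < σ) {S : Set ℝ} (hS : MeasurableSet S) (hS0 : S ⊆ Set.Ioi 0) {h : ℝ → ℂ}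
    (hh : IntegrableOn (fun x : ℝ => h x * (x : ℂ) ^ (-(σ : ℂ))) S) :
    ∫ t : ℝ, (∫ x in S, h x * (x : ℂ) ^ (-(σ + t * I : ℂ))) * mellin f (σ + t * I)
      = 2 * π * ∫ x in S, h x * f x := by
  have hint := integrable_mellin_vertical hf hc hσ
  have hsplit : ∀ x ∈ S, ∀ t : ℝ, h x * (x : ℂ) ^ (-(σ + t * I : ℂ)) =
      h x * (x : ℂ) ^ (-(σ : ℂ)) * cexp (-(t * Real.log x : ℝ) * I) := by
    intro x hx t
    have hx0 : (0 : ℝ) < x := hS0 hx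
    have hx' : (x : ℂ) ≠ 0 := by exact_mod_cast hx0.ne'
    rw [mul_assoc, neg_add, cpow_add _ _ hx', cpow_def_of_ne_zero hx' (-(t * I)),
      ← ofReal_log hx0.le]
    congr 3
    push_cast; ring
  have hprod : Integrable (fun p : ℝ × ℝ => mellin f (σ + p.1 * I) *
      (h p.2 * (p.2 : ℂ) ^ (-(σ : ℂ))) * cexp (-(p.1 * Real.log p.2 : ℝ) * I))
      (volume.prod (volume.restrict S)) := by
    have h1 := hint.mul_prod hh
    refine h1.norm.mono' (h1.aestronglyMeasurable.mul (Measurable.aestronglyMeasurable ?_))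
      (ae_of_all _ fun p => ?_)
    · fun_prop
    · rw [norm_mul _ (cexp _), ← ofReal_neg (p.1 * _), norm_exp_ofReal_mul_I, mul_one]
  calc _ = ∫ t : ℝ, ∫ x in S, mellin f (σ + t * I) *
      (h x * (x : ℂ) ^ (-(σ : ℂ))) * cexp (-(t * Real.log x : ℝ) * I) := by
        refine integral_congr_ae (ae_of_all _ fun t => ?_)
        simp only
        rw [mul_comm, ← integral_const_mul]
        refine setIntegral_congr_fun hS fun x hx => ?_
        simp only [hsplit x hx t, mul_assoc]
    _ = ∫ x in S, ∫ t : ℝ, mellin f (σ + t * I) *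
      (h x * (x : ℂ) ^ (-(σ : ℂ))) * cexp (-(t * Real.log x : ℝ) * I) :=
        integral_integral_swap hprod
    _ = ∫ x in S, 2 * π * (h x * f x) := by
        refine setIntegral_congr_fun hS fun x hx => ?_
        rw [mul_left_comm, ← integral_cpow_mul_mellin hf hc hσ (hS0 hx), ← integral_const_mul]
        refine integral_congr_ae (ae_of_all _ fun t => ?_)
        simp only
        rw [← mul_assoc (h x), hsplit x hx t]
        ring
    _ = _ := by rw [integral_const_mul]

/-- The Mellin transform of a product as a convolution of Mellin transforms. -/
lemma integral_mellin_mul_mellin {g : ℝ → ℂ} (hf : ContDiff ℝ (⊤ : ℕ∞) f)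
    (hc : HasCompactSupport f) (hg : Continuous g) (hgc : HasCompactSupport g) {σ : ℝ}
    (hσ : 0 < σ) {s : ℂ} (hs : σ < s.re) :
    ∫ t : ℝ, mellin g (s - (σ + t * I)) * mellin f (σ + t * I)
      = 2 * π * mellin (fun x => g x * f x) s := by
  have hcp : ∀ x ∈ Set.Ioi (0 : ℝ), ∀ w : ℂ, g x * (x : ℂ) ^ (s - 1) * (x : ℂ) ^ (-w) =
      (x : ℂ) ^ (s - w - 1) • g x := by
    intro x hx w
    have hx' : (x : ℂ) ≠ 0 := by exact_mod_cast (ne_of_gt hx)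
    rw [smul_eq_mul, mul_assoc, ← cpow_add _ _ hx', mul_comm]
    ring_nf
  have h := integral_integral_cpow_mul_mellin hf hc hσ measurableSet_Ioi subset_rfl
    (h := fun x => g x * (x : ℂ) ^ (s - 1)) (by
      have := hg.mellinConvergent_of_hasCompactSupport hgc (s := s - σ) (by simpa using hs)
      exact this.congr_fun (fun x hx => (hcp x hx σ).symm) measurableSet_Ioi)
  have h2 : ∀ t : ℝ, ∫ x in Set.Ioi (0 : ℝ), g x * (x : ℂ) ^ (s - 1) * (x : ℂ) ^ (-(σ + t * I : ℂ))
      = mellin g (s - (σ + t * I)) := fun t =>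
    setIntegral_congr_fun measurableSet_Ioi fun x hx => hcp x hx _
  simp only [h2] at h
  rw [h, mellin]
  congr 1
  refine setIntegral_congr_fun measurableSet_Ioi fun x hx => ?_
  simp only [smul_eq_mul]
  ring

end Mellin

/-- Shifting a vertical line of integration inside a strip of holomorphy. -/
lemma integral_vertical_eq_of_differentiableOn {a b C : ℝ} (hab : a ≤ b) {h : ℂ → ℂ}
    (hd : DifferentiableOn ℂ h {s | a ≤ s.re ∧ s.re ≤ b})
    (hC : ∀ s : ℂ, a ≤ s.re → s.re ≤ b → ‖h s‖ ≤ C * (1 + s.im ^ 2)⁻¹) :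
    ∫ t : ℝ, h (a + t * I) = ∫ t : ℝ, h (b + t * I) := by
  have hint : ∀ σ : ℝ, a ≤ σ → σ ≤ b → Integrable fun t : ℝ => h (σ + t * I) := by
    intro σ h1 h2
    have hcont : Continuous fun t : ℝ => h (σ + t * I) :=
      hd.continuousOn.comp_continuous (by fun_prop) (fun t => by simp [h1, h2])
    refine (integrable_inv_one_add_sq.const_mul C).mono' hcont.aestronglyMeasurable
      (ae_of_all _ fun t => ?_)
    simpa using hC (σ + t * I) (by simpa using h1) (by simpa using h2)
  have hvert : ∀ σ : ℝ, a ≤ σ → σ ≤ b →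
      Tendsto (fun T : ℝ => ∫ y in (-T)..T, h (σ + y * I)) atTop
        (nhds (∫ t : ℝ, h (σ + t * I))) := fun σ h1 h2 =>
    intervalIntegral_tendsto_integral (hint σ h1 h2) tendsto_neg_atTop_atBot tendsto_id
  have hlim : Tendsto (fun T : ℝ => C * (1 + T ^ 2)⁻¹ * |b - a|) atTop (nhds 0) := by
    have : Tendsto (fun T : ℝ => (1 + T ^ 2)⁻¹) atTop (nhds 0) :=
      tendsto_inv_atTop_zero.comp
        (tendsto_atTop_add_const_left _ _ (tendsto_pow_atTop (by norm_num)))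
    simpa using (this.const_mul C).mul_const |b - a|
  have hhor : ∀ φ : ℝ → ℝ, (∀ T, φ T ^ 2 = T ^ 2) →
      Tendsto (fun T : ℝ => ∫ x in a..b, h (x + φ T * I)) atTop (nhds 0) := by
    intro φ hφ
    refine squeeze_zero_norm (fun T => ?_) hlim
    refine intervalIntegral.norm_integral_le_of_norm_le_const fun x hx => ?_
    rw [Set.uIoc_of_le hab] at hx
    simpa [hφ] using hC (x + φ T * I) (by simpa using hx.1.le) (by simpa using hx.2)
  have hrect : ∀ T : ℝ, (∫ x in a..b, h (x + (-T : ℝ) * I)) - (∫ x in a..b, h (x + T * I)) +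
      I * (∫ y in (-T)..T, h (b + y * I)) - I * (∫ y in (-T)..T, h (a + y * I)) = 0 := by
    intro T
    have := integral_boundary_rect_eq_zero_of_differentiableOn h (a + (-T : ℝ) * I) (b + T * I)
      (hd.mono fun s hs => by
        have := (mem_reProdIm.1 hs).1
        simpa [Set.uIcc_of_le hab] using this)
    simpa using this
  have hT := (((hhor (fun T => -T) (by simp)).sub (hhor (fun T => T) (by simp))).add
    ((hvert b hab le_rfl).const_mul I)).sub ((hvert a le_rfl hab).const_mul I)
  have h0 := tendsto_nhds_unique hT (tendsto_const_nhds.congr fun T => (hrect T).symm)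
  rw [sub_zero, zero_add, ← mul_sub] at h0
  exact (sub_eq_zero.1 ((mul_eq_zero.1 h0).resolve_left I_ne_zero)).symm

section Kernel

variable {X : ℝ} {s : ℂ} (κ : ℝ)

lemma integrableOn_log_mul_cpow (hX : 0 < X) (hs : 0 < s.re) :
    IntegrableOn (fun x : ℝ => ((Real.log (x * X) - κ : ℝ) : ℂ) * (x : ℂ) ^ (-s - 1))
      (Set.Ioi X⁻¹) := by
  have hX' : 0 < X⁻¹ := inv_pos.2 hX
  have h1 := (integrableOn_Ioi_rpow_of_lt (a := s.re / 2 + (-s.re - 1)) (by linarith)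
    hX').const_mul (X ^ (s.re / 2) / (s.re / 2))
  have h2 := (integrableOn_Ioi_rpow_of_lt (a := -s.re - 1) (by linarith) hX').const_mul |κ|
  refine (h1.add h2).mono' ?_ ?_
  · refine Measurable.aestronglyMeasurable ?_
    fun_prop
  · filter_upwards [ae_restrict_mem measurableSet_Ioi] with x hx
    have hx0 : 0 < x := hX'.trans hx
    have hxX : 1 ≤ x * X := by
      have := mul_le_mul_of_nonneg_right (le_of_lt (Set.mem_Ioi.1 hx)) hX.le
      rwa [inv_mul_cancel₀ hX.ne'] at this
    rw [norm_mul, norm_cpow_eq_rpow_re_of_pos hx0, norm_real]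
    have h3 : ‖Real.log (x * X) - κ‖ ≤ x ^ (s.re / 2) * X ^ (s.re / 2) / (s.re / 2) + |κ| := by
      refine (norm_sub_le _ _).trans (add_le_add ?_ le_rfl)
      rw [Real.norm_of_nonneg (Real.log_nonneg hxX), ← Real.mul_rpow hx0.le hX.le]
      exact Real.log_le_rpow_div (by positivity) (by positivity)
    refine (mul_le_mul_of_nonneg_right h3 (by positivity)).trans (le_of_eq ?_)
    simp only [Pi.add_apply, Real.rpow_add hx0, sub_re, neg_re, one_re]
    ring

lemma tendsto_log_sub_mul_cpow (hX : 0 < X) (hs : 0 < s.re) :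
    Tendsto (fun x : ℝ => -(x : ℂ) ^ (-s) * (((Real.log (x * X) - κ : ℝ) : ℂ) / s + 1 / s ^ 2))
      atTop (nhds 0) := by
  have h1 : Tendsto (fun x : ℝ => (x : ℂ) ^ (-s)) atTop (nhds 0) := by
    rw [tendsto_zero_iff_norm_tendsto_zero]
    refine (tendsto_rpow_neg_atTop hs).congr' ?_
    filter_upwards [eventually_gt_atTop 0] with x hx
    rw [norm_cpow_eq_rpow_re_of_pos hx, neg_re]
  have h2 : Tendsto (fun x : ℝ => (Real.log x : ℂ) * (x : ℂ) ^ (-s)) atTop (nhds 0) := by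
    rw [tendsto_zero_iff_norm_tendsto_zero]
    have h := (isLittleO_log_rpow_atTop hs).tendsto_div_nhds_zero.norm
    rw [norm_zero] at h
    refine h.congr' ?_
    filter_upwards [eventually_gt_atTop 0] with x hx
    rw [norm_mul, norm_cpow_eq_rpow_re_of_pos hx, neg_re, norm_real, Real.rpow_neg hx.le, norm_div,
      Real.norm_of_nonneg (by positivity : 0 ≤ x ^ s.re), div_eq_mul_inv]
  have h3 := (h2.mul_const (-1 / s)).add
    (h1.mul_const (-(((Real.log X - κ : ℝ) : ℂ) / s + 1 / s ^ 2)))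
  simp only [zero_mul, add_zero] at h3
  refine h3.congr' ?_
  filter_upwards [eventually_gt_atTop 0] with x hx
  rw [Real.log_mul hx.ne' hX.ne']
  push_cast
  ring

lemma integral_log_sub_mul_cpow (hX : 0 < X) (hs : 0 < s.re) :
    ∫ x in Set.Ioi X⁻¹, ((Real.log (x * X) - κ : ℝ) : ℂ) * (x : ℂ) ^ (-s - 1) =
      (X : ℂ) ^ s * (1 / s ^ 2 - κ / s) := by
  have hX' : 0 < X⁻¹ := inv_pos.2 hX
  have hs0 : s ≠ 0 := by rintro rfl; simp at hs
  have hder : ∀ x ∈ Set.Ici X⁻¹, HasDerivAt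
      (fun x : ℝ => -(x : ℂ) ^ (-s) * (((Real.log (x * X) - κ : ℝ) : ℂ) / s + 1 / s ^ 2))
      (((Real.log (x * X) - κ : ℝ) : ℂ) * (x : ℂ) ^ (-s - 1)) x := by
    intro x hx
    have hx0 : 0 < x := hX'.trans_le hx
    have hx' : (x : ℂ) ≠ 0 := by exact_mod_cast hx0.ne'
    have h1 : HasDerivAt (fun y : ℝ => (y : ℂ) ^ (-s)) (-s * (x : ℂ) ^ (-s - 1)) x := by
      simpa [Function.comp_def] using
        ((hasDerivAt_id ((x : ℝ) : ℂ)).cpow_const (c := -s) (by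
          rw [id, ofReal_mem_slitPlane]; exact hx0)).comp x (ofRealCLM.hasDerivAt (x := x))
    have h2 : HasDerivAt (fun y : ℝ => Real.log (y * X) - κ) (1 * X / (x * X)) x :=
      (((hasDerivAt_id x).mul_const X).log (by simp [hx0.ne', hX.ne'])).sub_const κ
    have h3 := h1.neg.mul ((h2.ofReal_comp.div_const s).add_const (1 / s ^ 2))
    refine h3.congr_deriv ?_
    rw [Pi.neg_apply]
    have hXc : (X : ℂ) ≠ 0 := by exact_mod_cast hX.ne'
    rw [cpow_sub _ _ hx', cpow_one]
    push_cast
    field_simp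
    ring
  rw [integral_Ioi_of_hasDerivAt_of_tendsto' hder (integrableOn_log_mul_cpow κ hX hs)
    (tendsto_log_sub_mul_cpow κ hX hs), inv_mul_cancel₀ hX.ne', Real.log_one, ofReal_inv,
    inv_cpow _ _ (by rw [arg_ofReal_of_nonneg hX.le]; exact pi_ne_zero.symm), cpow_neg, inv_inv]
  push_cast
  ring

end Kernel

lemma integral_polar_mul_mellin {f : ℝ → ℂ} (hf : ContDiff ℝ (⊤ : ℕ∞) f)
    (hc : HasCompactSupport f) {X c : ℝ} (κ : ℝ) (hX : 0 < X) (h0 : 0 < c) :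
    ∫ t : ℝ, (X : ℂ) ^ (c + t * I : ℂ) * (1 / (c + t * I : ℂ) ^ 2 - κ / (c + t * I : ℂ)) *
        mellin f ((1 + c : ℝ) + t * I) =
      2 * π * ∫ x in Set.Ioi X⁻¹, ((Real.log (x * X) - κ : ℝ) : ℂ) * f x := by
  have hX' : 0 < X⁻¹ := inv_pos.2 hX
  have hsub : Set.Ioi X⁻¹ ⊆ Set.Ioi (0 : ℝ) := Set.Ioi_subset_Ioi hX'.le
  have he : ∀ s : ℂ, -s - 1 = -(1 + s) := fun s => by ring
  rw [← integral_integral_cpow_mul_mellin hf hc (σ := 1 + c) (by linarith) measurableSet_Ioi hsub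
    (by simpa [he] using integrableOn_log_mul_cpow κ hX (s := c) (by simpa))]
  refine integral_congr_ae (ae_of_all _ fun t => ?_)
  have := integral_log_sub_mul_cpow κ hX (s := c + t * I) (by simpa)
  rw [he, ← add_assoc] at this
  simp only [← this]
  push_cast
  rfl

lemma locallyIntegrable_log : LocallyIntegrable Real.log := by
  intro x
  refine ⟨Set.Ioc (x - 1) (x + 1), Ioc_mem_nhds (by linarith) (by linarith), ?_⟩
  exact (intervalIntegrable_iff_integrableOn_Ioc_of_le (by linarith)).1
    intervalIntegral.intervalIntegrable_log'

/-- Removing the truncation at `X⁻¹` from the integral of `log (x * X) - κ` against a bounded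
function costs `O(X⁻¹)`. -/
lemma norm_integral_log_sub_mul_sub_le {φ : ℝ → ℝ} (hφ : Continuous φ) (hφc : HasCompactSupport φ)
    {M : ℝ} (hM : ∀ x, ‖φ x‖ ≤ M) (κ : ℝ) {X : ℝ} (hX : 0 < X) :
    ‖(∫ x in Set.Ioi X⁻¹, (Real.log (x * X) - κ) * φ x) -
        ((∫ x in Set.Ioi 0, φ x) * Real.log X + (∫ x in Set.Ioi 0, Real.log x * φ x) -
          κ * ∫ x in Set.Ioi 0, φ x)‖ ≤ (∫ y in (0 : ℝ)..1, ‖Real.log y - κ‖ * M) * X⁻¹ := by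
  have hX' : 0 < X⁻¹ := inv_pos.2 hX
  have hφi : IntegrableOn φ (Set.Ioi 0) := (hφ.integrable_of_hasCompactSupport hφc).integrableOn
  have hlφ : IntegrableOn (fun x => Real.log x * φ x) (Set.Ioi 0) := by
    simpa [mul_comm] using
      (locallyIntegrable_log.integrable_smul_left_of_hasCompactSupport hφ hφc).integrableOn
  have heq : Set.EqOn (fun x => (Real.log (x * X) - κ) * φ x)
      (fun x => (Real.log X - κ) * φ x + Real.log x * φ x) (Set.Ioi 0) := fun x hx => by
    simp only [Real.log_mul (ne_of_gt hx) hX.ne']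
    ring
  have hint : IntegrableOn (fun x => (Real.log (x * X) - κ) * φ x) (Set.Ioi 0) :=
    IntegrableOn.congr_fun ((hφi.const_mul (Real.log X - κ)).add hlφ) heq.symm measurableSet_Ioi
  have htot : (∫ x in Set.Ioi 0, φ x) * Real.log X + (∫ x in Set.Ioi 0, Real.log x * φ x) -
      κ * ∫ x in Set.Ioi 0, φ x = ∫ x in Set.Ioi 0, (Real.log (x * X) - κ) * φ x := by
    rw [setIntegral_congr_fun measurableSet_Ioi heq,
      integral_add (hφi.const_mul (Real.log X - κ)) hlφ, integral_const_mul]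
    ring
  have hsplit : ∫ x in Set.Ioi 0, (Real.log (x * X) - κ) * φ x =
      (∫ x in (0 : ℝ)..X⁻¹, (Real.log (x * X) - κ) * φ x) +
        ∫ x in Set.Ioi X⁻¹, (Real.log (x * X) - κ) * φ x :=
    (intervalIntegral.integral_interval_add_Ioi hint (hint.mono_set (Set.Ioi_subset_Ioi hX'.le))).symm
  rw [htot, hsplit, sub_add_cancel_right, norm_neg]
  have hlog : IntervalIntegrable (fun y => ‖Real.log y - κ‖ * M) volume 0 1 :=
    ((intervalIntegral.intervalIntegrable_log'.sub intervalIntegrable_const).norm).mul_const M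
  have hbd := intervalIntegral.norm_integral_le_of_norm_le (μ := volume) hX'.le
    (f := fun x => (Real.log (x * X) - κ) * φ x) (g := fun x => ‖Real.log (x * X) - κ‖ * M)
    (ae_of_all _ fun x _ => by rw [norm_mul]; gcongr; exact hM x)
    (by simpa using hlog.comp_mul_right (c := X))
  refine hbd.trans (le_of_eq ?_)
  rw [intervalIntegral.integral_comp_mul_right (fun y => ‖Real.log y - κ‖ * M) hX.ne', zero_mul,
    inv_mul_cancel₀ hX.ne', smul_eq_mul, mul_comm]

lemma one_add_sq_sq_mul_inv_mul_inv_le (w t : ℝ) :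
    (1 + w ^ 2) ^ 2 * ((1 + (w - t) ^ 2) ^ 3)⁻¹ * ((1 + t ^ 2) ^ 3)⁻¹ ≤
      4 * (1 + (w - t) ^ 2)⁻¹ * (1 + t ^ 2)⁻¹ := by
  have h : 1 + w ^ 2 ≤ 2 * ((1 + (w - t) ^ 2) * (1 + t ^ 2)) := by
    nlinarith [sq_nonneg (w - 2 * t), sq_nonneg ((w - t) * t)]
  have h2 : (1 + w ^ 2) ^ 2 ≤ 4 * ((1 + (w - t) ^ 2) ^ 2 * (1 + t ^ 2) ^ 2) :=
    (pow_le_pow_left₀ (by positivity) h 2).trans (le_of_eq (by ring))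
  refine (mul_le_mul_of_nonneg_right (mul_le_mul_of_nonneg_right h2 (by positivity))
    (by positivity)).trans (le_of_eq ?_)
  field_simp

/-- A double integral of Mellin transforms against a kernel depending only on the sum of the two
ordinates reduces to a single integral of the Mellin transform of the product. -/
lemma integral_integral_mul_mellin_mul_mellin {f g : ℝ → ℂ} (hf : ContDiff ℝ (⊤ : ℕ∞) f)
    (hc : HasCompactSupport f) (hg : ContDiff ℝ (⊤ : ℕ∞) g) (hgc : HasCompactSupport g)
    {a b C : ℝ} (ha : 0 < a) (hb : 0 < b) {K : ℝ → ℂ} (hK : Continuous K)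
    (hKb : ∀ t, ‖K t‖ ≤ C * (1 + t ^ 2) ^ 2) :
    ∫ u : ℝ, ∫ t : ℝ, K (t + u) * mellin g (a + t * I) * mellin f (b + u * I) =
      2 * π * ∫ w : ℝ, K w * mellin (fun x => g x * f x) ((a + b : ℝ) + w * I) := by
  obtain ⟨Cf, hCf, hfb⟩ := exists_norm_mellin_le (b := b) hb hf hc
  obtain ⟨Cg, hCg, hgb⟩ := exists_norm_mellin_le (b := a) ha hg hgc
  have hC : 0 ≤ C := by simpa using (norm_nonneg _).trans (hKb 0)
  have hint : Integrable (fun p : ℝ × ℝ =>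
      K p.2 * mellin g (a + (p.2 - p.1 : ℝ) * I) * mellin f (b + p.1 * I))
      (volume.prod volume) := by
    have h1 := (integrable_inv_one_add_sq.convolution_integrand (ContinuousLinearMap.mul ℝ ℝ)
      integrable_inv_one_add_sq (μ := volume) (ν := volume)).swap.const_mul (4 * C * Cg * Cf)
    refine h1.mono' (Continuous.aestronglyMeasurable ?_) (ae_of_all _ fun p => ?_)
    · exact ((hK.comp continuous_snd).mul ((continuous_mellin_vertical hg.continuous hgc ha).comp
        (continuous_snd.sub continuous_fst))).mul
        ((continuous_mellin_vertical hf.continuous hc hb).comp continuous_fst)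
    · obtain ⟨u, w⟩ := p
      have h2 := hgb (a + (w - u : ℝ) * I) (by simp) (by simp)
      have h3 := hfb (b + u * I) (by simp) (by simp)
      have him2 : (a + (w - u : ℝ) * I : ℂ).im = w - u := by simp
      have him3 : (b + u * I : ℂ).im = u := by simp
      rw [him2] at h2
      rw [him3] at h3
      simp only [norm_mul, Function.comp_apply, Prod.swap_prod_mk, ContinuousLinearMap.mul_apply']
      calc _ ≤ C * (1 + w ^ 2) ^ 2 * (Cg * ((1 + (w - u) ^ 2) ^ 3)⁻¹) *
            (Cf * ((1 + u ^ 2) ^ 3)⁻¹) := by gcongr; exact hKb w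
        _ = C * Cg * Cf *
            ((1 + w ^ 2) ^ 2 * ((1 + (w - u) ^ 2) ^ 3)⁻¹ * ((1 + u ^ 2) ^ 3)⁻¹) := by ring
        _ ≤ C * Cg * Cf * (4 * (1 + (w - u) ^ 2)⁻¹ * (1 + u ^ 2)⁻¹) := by
            exact mul_le_mul_of_nonneg_left (one_add_sq_sq_mul_inv_mul_inv_le w u) (by positivity)
        _ = _ := by ring
  calc _ = ∫ u : ℝ, ∫ w : ℝ, K w * mellin g (a + (w - u : ℝ) * I) * mellin f (b + u * I) := by
        refine integral_congr_ae (ae_of_all _ fun u => ?_)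
        beta_reduce
        rw [← integral_sub_right_eq_self
          (fun t : ℝ => K (t + u) * mellin g (a + t * I) * mellin f (b + u * I)) u]
        simp only [sub_add_cancel]
    _ = ∫ w : ℝ, ∫ u : ℝ, K w * mellin g (a + (w - u : ℝ) * I) * mellin f (b + u * I) :=
        integral_integral_swap hint
    _ = ∫ w : ℝ, 2 * π * (K w * mellin (fun x => g x * f x) ((a + b : ℝ) + w * I)) := by
        refine integral_congr_ae (ae_of_all _ fun w => ?_)
        beta_reduce
        rw [mul_left_comm, ← integral_mellin_mul_mellin hf hc hg.continuous hgc hb (by simpa),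
          ← integral_const_mul]
        refine integral_congr_ae (ae_of_all _ fun u => ?_)
        simp only [mul_assoc]
        congr 3
        push_cast
        ring
    _ = _ := by rw [integral_const_mul]

lemma sq_mul_inv_cube_eq (t : ℝ) : (1 + t ^ 2) ^ 2 * ((1 + t ^ 2) ^ 3)⁻¹ = (1 + t ^ 2)⁻¹ := by
  have : 1 + t ^ 2 ≠ 0 := by positivity
  field_simp

lemma integrable_mul_mellin_vertical {f : ℝ → ℂ} (hf : ContDiff ℝ (⊤ : ℕ∞) f)
    (hc : HasCompactSupport f) {σ C : ℝ} (hσ : 0 < σ) {K : ℝ → ℂ} (hK : Continuous K)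
    (hKb : ∀ t, ‖K t‖ ≤ C * (1 + t ^ 2) ^ 2) :
    Integrable fun t : ℝ => K t * mellin f (σ + t * I) := by
  obtain ⟨D, hD, h⟩ := exists_norm_mellin_le (b := σ) hσ hf hc
  refine (integrable_inv_one_add_sq.const_mul (C * D)).mono'
    (hK.mul (continuous_mellin_vertical hf.continuous hc hσ)).aestronglyMeasurable
    (ae_of_all _ fun t => ?_)
  have h1 := h (σ + t * I) (by simp) (by simp)
  have him : (σ + t * I : ℂ).im = t := by simp
  rw [him] at h1
  rw [norm_mul]
  refine (mul_le_mul (hKb t) h1 (norm_nonneg _) ((norm_nonneg _).trans (hKb t))).trans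
    (le_of_eq ?_)
  rw [← sq_mul_inv_cube_eq]
  ring

/-- Moving the line of integration from `re s = b` to `re s = a` saves a factor `X ^ (a - b)`. -/
lemma exists_norm_integral_mul_cpow_mul_mellin_le {f : ℝ → ℂ} (hf : ContDiff ℝ (⊤ : ℕ∞) f)
    (hc : HasCompactSupport f) {H : ℂ → ℂ} {a b C : ℝ} (ha : 0 < a) (hab : a ≤ b)
    (hH : DifferentiableOn ℂ H {s | a ≤ s.re ∧ s.re ≤ b})
    (hHb : ∀ s : ℂ, a ≤ s.re → s.re ≤ b → ‖H s‖ ≤ C * (1 + s.im ^ 2) ^ 2) :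
    ∃ D : ℝ, ∀ X : ℝ, 1 ≤ X →
      ‖∫ t : ℝ, H (b + t * I) * (X : ℂ) ^ (b + t * I - 1 : ℂ) * mellin f (b + t * I)‖
        ≤ D * X ^ (a - 1) := by
  obtain ⟨D, hD, h⟩ := exists_norm_mellin_le (b := b) ha hf hc
  refine ⟨∫ t : ℝ, C * D * (1 + t ^ 2)⁻¹, fun X hX => ?_⟩
  have hX0 : 0 < X := by linarith
  have hX' : (X : ℂ) ≠ 0 := by exact_mod_cast hX0.ne'
  have key : ∀ s : ℂ, a ≤ s.re → s.re ≤ b →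
      ‖H s * (X : ℂ) ^ (s - 1) * mellin f s‖ ≤ C * D * X ^ (s.re - 1) * (1 + s.im ^ 2)⁻¹ := by
    intro s h1 h2
    rw [norm_mul, norm_mul, norm_cpow_eq_rpow_re_of_pos hX0, sub_re, one_re]
    calc _ ≤ C * (1 + s.im ^ 2) ^ 2 * X ^ (s.re - 1) * (D * ((1 + s.im ^ 2) ^ 3)⁻¹) :=
          mul_le_mul (mul_le_mul_of_nonneg_right (hHb s h1 h2) (by positivity)) (h s h1 h2)
            (norm_nonneg _)
            (mul_nonneg ((norm_nonneg _).trans (hHb s h1 h2)) (by positivity))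
      _ = _ := by
          rw [← sq_mul_inv_cube_eq]
          ring
  have hC : 0 ≤ C := by
    simpa using (norm_nonneg _).trans (hHb a (by simp) (by simpa using hab))
  rw [← integral_vertical_eq_of_differentiableOn (C := C * D * X ^ (b - 1))
    (h := fun s => H s * (X : ℂ) ^ (s - 1) * mellin f s) hab]
  · rw [← integral_mul_const]
    refine norm_integral_le_of_norm_le
      ((integrable_inv_one_add_sq.const_mul (C * D)).mul_const _) (ae_of_all _ fun t => ?_)
    refine (key _ (by simp) (by simpa using hab)).trans (le_of_eq ?_)
    simp
    ring
  · refine (hH.mul fun s _ => ?_).mul fun s hs => ?_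
    · exact ((differentiableAt_id.sub_const 1).const_cpow (Or.inl hX')).differentiableWithinAt
    · exact (hf.continuous.differentiableAt_mellin_of_hasCompactSupport hc
        (ha.trans_le hs.1)).differentiableWithinAt
  · intro s h1 h2
    refine (key s h1 h2).trans ?_
    gcongr

lemma mellinC_eq_mellin (Φ : ℝ → ℝ) (s : ℂ) : mellinC Φ s = mellin (fun x => (Φ x : ℂ)) s := by
  simp only [mellinC, mellin, smul_eq_mul, mul_comm]

lemma norm_one_div_sq_sub_div_le {c : ℝ} (h0 : 0 < c) (κ t : ℝ) :
    ‖1 / (c + t * I : ℂ) ^ 2 - κ / (c + t * I : ℂ)‖ ≤ 1 / c ^ 2 + |κ| / c := by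
  have hn : c ≤ ‖(c + t * I : ℂ)‖ := by
    simpa [abs_of_pos h0] using abs_re_le_norm (c + t * I : ℂ)
  refine (norm_sub_le _ _).trans ?_
  rw [norm_div, norm_div, norm_pow, norm_one, norm_real, Real.norm_eq_abs]
  gcongr

/-- The double vertical integral as a single integral of `K` against the Mellin transform of
`Φ ^ 2`. -/
lemma neg_vertInt_vertInt_eq {Φ : ℝ → ℝ} (hΦ : ContDiff ℝ (⊤ : ℕ∞) Φ) (hΦc : HasCompactSupport Φ)
    {ε ε' C : ℝ} (hε : 0 < 1 / 2 + ε) (hε' : 0 < 1 / 2 + ε') {F : ℂ → ℂ} {X : ℝ} (hX : 0 < X)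
    (hF : Continuous fun t : ℝ => F ((1 + (ε + ε') : ℝ) + t * I))
    (hFb : ∀ t : ℝ, ‖F ((1 + (ε + ε') : ℝ) + t * I)‖ ≤ C * (1 + t ^ 2) ^ 2) :
    -vertInt (fun β => vertInt (fun α =>
        F (1 + α + β) * mellinC Φ (1 / 2 + α) * mellinC Φ (1 / 2 + β) * (X : ℂ) ^ (α + β)) ε) ε' =
      2 * π * ∫ w : ℝ, F ((1 + (ε + ε') : ℝ) + w * I) * (X : ℂ) ^ ((ε + ε' : ℝ) + w * I : ℂ) *
        mellin (fun x => ((Φ x ^ 2 : ℝ) : ℂ)) ((1 + (ε + ε') : ℝ) + w * I) := by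
  have hf : ContDiff ℝ (⊤ : ℕ∞) fun x => (Φ x : ℂ) := ofRealCLM.contDiff.comp hΦ
  have hc : HasCompactSupport fun x => (Φ x : ℂ) := hΦc.comp_left ofReal_zero
  have hX' : (X : ℂ) ≠ 0 := by exact_mod_cast hX.ne'
  have h := integral_integral_mul_mellin_mul_mellin hf hc hf hc hε hε'
    (K := fun t => F ((1 + (ε + ε') : ℝ) + t * I) * (X : ℂ) ^ ((ε + ε' : ℝ) + t * I : ℂ))
    (C := C * X ^ (ε + ε')) (hF.mul (by
      refine Continuous.const_cpow (by fun_prop) (Or.inl hX'))) (fun t => by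
      rw [norm_mul, norm_cpow_eq_rpow_re_of_pos hX]
      refine (mul_le_mul_of_nonneg_right (hFb t) (by positivity)).trans (le_of_eq ?_)
      simp
      ring)
  have hsum : 1 / 2 + ε + (1 / 2 + ε') = 1 + (ε + ε') := by ring
  rw [hsum] at h
  simp only [pow_two, ofReal_mul]
  rw [← h]
  simp only [vertInt, mellinC_eq_mellin]
  rw [integral_const_mul, ← mul_assoc, I_mul_I, neg_one_mul, neg_neg]
  refine integral_congr_ae (ae_of_all _ fun u => integral_congr_ae (ae_of_all _ fun t => ?_))
  beta_reduce
  have e1 : (1 + (ε + t * I) + (ε' + u * I) : ℂ) = (1 + (ε + ε') : ℝ) + (t + u : ℝ) * I := by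
    push_cast; ring
  have e2 : (ε + t * I + (ε' + u * I) : ℂ) = (ε + ε' : ℝ) + (t + u : ℝ) * I := by
    push_cast; ring
  have e3 : (1 / 2 + (ε + t * I) : ℂ) = (1 / 2 + ε : ℝ) + t * I := by push_cast; ring
  have e4 : (1 / 2 + (ε' + u * I) : ℂ) = (1 / 2 + ε' : ℝ) + u * I := by push_cast; ring
  rw [e1, e2, e3, e4]
  ring

theorem zeta_log_deriv_squared_integral
    (hRH : ∀ s : ℂ, 0 < s.re → s.re < 1 → riemannZeta s = 0 → s.re = 1 / 2)
    (Φ : ℝ → ℝ) (hΦ : ContDiff ℝ (⊤ : ℕ∞) Φ) (hΦc : HasCompactSupport Φ)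
    (hΦsupp : Function.support Φ ⊆ Set.Ioi 0)
    (ε ε' : ℝ) (hε : ε ∈ Set.Ioo (0:ℝ) (1/4)) (hε' : ε' ∈ Set.Ioo (0:ℝ) (1/4)) :
    (fun X : ℝ =>
        -vertInt
            (fun β =>
              vertInt
                (fun α =>
                  (deriv riemannZeta (1 + α + β) / riemannZeta (1 + α + β)) ^ 2 *
                      mellinC Φ (1 / 2 + α) * mellinC Φ (1 / 2 + β) * (X : ℂ) ^ (α + β))
                ε)
            ε' -
          ((CPhi Φ * Real.log X + CPhi' Φ -
              2 * Real.eulerMascheroniConstant * CPhi Φ : ℝ) : ℂ))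
      =O[atTop] (fun X : ℝ => X ^ (-(2 : ℝ) / 5)) := by
  obtain ⟨H, C, hC, hHd, hHeq, hHb⟩ := exists_regularPart_logDeriv_riemannZeta_sq hRH
  set κ : ℝ := 2 * Real.eulerMascheroniConstant with hκ
  obtain ⟨hε0, hε1⟩ := hε
  obtain ⟨hε0', hε1'⟩ := hε'
  obtain ⟨c, hcdef⟩ : ∃ c, c = ε + ε' := ⟨_, rfl⟩
  have hc0 : 0 < c := by linarith
  have hc1 : c < 1 / 2 := by linarith
  let f : ℝ → ℂ := fun x => ((Φ x ^ 2 : ℝ) : ℂ)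
  have hf : ContDiff ℝ (⊤ : ℕ∞) f := ofRealCLM.contDiff.comp (hΦ.pow 2)
  have hφc : HasCompactSupport fun x => Φ x ^ 2 := hΦc.comp_left (g := fun y => y ^ 2) (by simp)
  have hfc : HasCompactSupport f := hφc.comp_left ofReal_zero
  have hre : ∀ t : ℝ, ((1 + c : ℝ) + t * I : ℂ).re = 1 + c := fun t => by simp
  have him : ∀ t : ℝ, ((1 + c : ℝ) + t * I : ℂ).im = t := fun t => by simp
  have hsub : ∀ t : ℝ, ((1 + c : ℝ) + t * I : ℂ) - 1 = c + t * I := fun t => by push_cast; ring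
  have hne : ∀ t : ℝ, (c + t * I : ℂ) ≠ 0 := fun t h => by
    have := congrArg Complex.re h
    simp at this
    linarith
  let P : ℝ → ℂ := fun t => 1 / (c + t * I : ℂ) ^ 2 - κ / (c + t * I : ℂ)
  have hPc : Continuous P :=
    (continuous_const.div (by fun_prop) fun t => pow_ne_zero 2 (hne t)).sub
      (continuous_const.div (by fun_prop) hne)
  have hPb : ∀ t, ‖P t‖ ≤ (1 / c ^ 2 + |κ| / c) * (1 + t ^ 2) ^ 2 := fun t =>
    (norm_one_div_sq_sub_div_le hc0 κ t).trans
      (le_mul_of_one_le_right (by positivity) (one_le_pow₀ (by nlinarith [sq_nonneg t])))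
  have hHc : Continuous fun t : ℝ => H ((1 + c : ℝ) + t * I) :=
    hHd.continuousOn.comp_continuous (by fun_prop) fun t => by
      rw [Set.mem_ofPred_eq, hre]; linarith
  have hHb' : ∀ t : ℝ, ‖H ((1 + c : ℝ) + t * I)‖ ≤ C * (1 + t ^ 2) ^ 2 := fun t => by
    simpa [him] using hHb ((1 + c : ℝ) + t * I) (by rw [hre]; linarith) (by rw [hre]; linarith)
  have hF : ∀ t : ℝ, (deriv riemannZeta ((1 + c : ℝ) + t * I) /
      riemannZeta ((1 + c : ℝ) + t * I)) ^ 2 = H ((1 + c : ℝ) + t * I) + P t := fun t => by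
    have hs1 : ((1 + c : ℝ) + t * I : ℂ) ≠ 1 := fun h => hne t (by rw [← hsub, h, sub_self])
    rw [hHeq _ (by rw [hre]; linarith) hs1, hsub]
    simp [P, hκ]
  obtain ⟨D, hD⟩ := exists_norm_integral_mul_cpow_mul_mellin_le hf hfc (H := H) (a := 3 / 5)
    (b := 1 + c) (by norm_num) (by linarith)
    (hHd.mono fun s hs => by have := hs.1; rw [Set.mem_ofPred_eq]; linarith)
    (fun s h1 h2 => hHb s h1 (by linarith))
  obtain ⟨M, hM⟩ := hφc.exists_bound_of_continuous (hΦ.continuous.pow 2)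
  have hexp : ∀ X : ℝ, 1 ≤ X → -vertInt (fun β => vertInt (fun α =>
      (deriv riemannZeta (1 + α + β) / riemannZeta (1 + α + β)) ^ 2 *
        mellinC Φ (1 / 2 + α) * mellinC Φ (1 / 2 + β) * (X : ℂ) ^ (α + β)) ε) ε' =
      2 * π * (∫ t : ℝ, H ((1 + c : ℝ) + t * I) * (X : ℂ) ^ ((1 + c : ℝ) + t * I - 1 : ℂ) *
        mellin f ((1 + c : ℝ) + t * I)) +
      ((4 * π ^ 2 * ∫ x in Set.Ioi X⁻¹, (Real.log (x * X) - κ) * Φ x ^ 2 : ℝ) : ℂ) := by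
    intro X hX
    have hX0 : 0 < X := by linarith
    have hX' : (X : ℂ) ≠ 0 := by exact_mod_cast hX0.ne'
    have hXc : Continuous fun t : ℝ => (X : ℂ) ^ (c + t * I : ℂ) :=
      Continuous.const_cpow (by fun_prop) (Or.inl hX')
    have hXn : ∀ t : ℝ, ‖(X : ℂ) ^ (c + t * I : ℂ)‖ = X ^ c := fun t => by
      rw [norm_cpow_eq_rpow_re_of_pos hX0]; simp
    have hbound : ∀ {L : ℝ → ℂ} {B : ℝ}, (∀ t, ‖L t‖ ≤ B * (1 + t ^ 2) ^ 2) →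
        ∀ t : ℝ, ‖L t * (X : ℂ) ^ (c + t * I : ℂ)‖ ≤ B * X ^ c * (1 + t ^ 2) ^ 2 :=
      fun hL t => by
        rw [norm_mul, hXn, mul_right_comm]
        exact mul_le_mul_of_nonneg_right (hL t) (by positivity)
    have hi1 : Integrable fun t : ℝ => H ((1 + c : ℝ) + t * I) * (X : ℂ) ^ (c + t * I : ℂ) *
        mellin f ((1 + c : ℝ) + t * I) := integrable_mul_mellin_vertical hf hfc (σ := 1 + c) (by linarith) (hHc.mul hXc)
      (hbound hHb')
    have hi2 : Integrable fun t : ℝ => P t * (X : ℂ) ^ (c + t * I : ℂ) *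
        mellin f ((1 + c : ℝ) + t * I) := integrable_mul_mellin_vertical hf hfc (σ := 1 + c) (by linarith) (hPc.mul hXc)
      (hbound hPb)
    have hreal : ∫ x in Set.Ioi X⁻¹, ((Real.log (x * X) - κ : ℝ) : ℂ) * f x =
        ((∫ x in Set.Ioi X⁻¹, (Real.log (x * X) - κ) * Φ x ^ 2 : ℝ) : ℂ) := by
      rw [← integral_complex_ofReal]
      simp [f]
    have hpol : ∫ t : ℝ, P t * (X : ℂ) ^ (c + t * I : ℂ) * mellin f ((1 + c : ℝ) + t * I) =
        2 * π * ((∫ x in Set.Ioi X⁻¹, (Real.log (x * X) - κ) * Φ x ^ 2 : ℝ) : ℂ) := by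
      rw [← hreal, ← integral_polar_mul_mellin hf hfc κ hX0 hc0]
      exact integral_congr_ae (ae_of_all _ fun t => by simp only [P]; ring)
    rw [neg_vertInt_vertInt_eq hΦ hΦc (C := C + (1 / c ^ 2 + |κ| / c)) (by linarith) (by linarith)
      (F := fun s => (deriv riemannZeta s / riemannZeta s) ^ 2) hX0, ← hcdef]
    · simp only [hF, hsub]
      have hsplit : ∀ t : ℝ, (H ((1 + c : ℝ) + t * I) + P t) * (X : ℂ) ^ (c + t * I : ℂ) *
          mellin f ((1 + c : ℝ) + t * I) =
          H ((1 + c : ℝ) + t * I) * (X : ℂ) ^ (c + t * I : ℂ) * mellin f ((1 + c : ℝ) + t * I) +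
          P t * (X : ℂ) ^ (c + t * I : ℂ) * mellin f ((1 + c : ℝ) + t * I) := fun t => by ring
      simp only [f] at hsplit hi1 hi2 hpol ⊢
      simp only [hsplit]
      rw [integral_add hi1 hi2, hpol, ofReal_mul, ofReal_mul, ofReal_pow, ofReal_ofNat]
      ring
    · simp only [← hcdef, hF]
      exact hHc.add hPc
    · intro t
      simp only [← hcdef, hF]
      rw [add_mul]
      exact (norm_add_le _ _).trans (add_le_add (hHb' t) (hPb t))
  refine IsBigO.of_bound
    (2 * π * |D| + 4 * π ^ 2 * |∫ y in (0 : ℝ)..1, ‖Real.log y - κ‖ * M|) ?_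
  filter_upwards [eventually_ge_atTop 1] with X hX
  have hX0 : 0 < X := by linarith
  have hpow : X⁻¹ ≤ X ^ (-(2 : ℝ) / 5) := by
    rw [← Real.rpow_neg_one]
    exact Real.rpow_le_rpow_of_exponent_le hX (by norm_num)
  have h1 := hD X hX
  have h2 := norm_integral_log_sub_mul_sub_le (hΦ.continuous.pow 2) hφc hM κ hX0
  rw [hexp X hX, add_sub_assoc, ← ofReal_sub, Real.norm_of_nonneg (by positivity), add_mul]
  refine (norm_add_le _ _).trans (add_le_add ?_ ?_)
  · rw [norm_mul, norm_mul, norm_real, Real.norm_of_nonneg pi_pos.le, RCLike.norm_ofNat,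
      mul_assoc (2 * π)]
    refine mul_le_mul_of_nonneg_left (h1.trans ?_) (by positivity)
    rw [show (3 / 5 - 1 : ℝ) = -2 / 5 by norm_num]
    gcongr
    exact le_abs_self D
  · rw [norm_real, CPhi, CPhi']
    rw [show ∀ A B E L : ℝ, 4 * π ^ 2 * A - (4 * π ^ 2 * B * L + 4 * π ^ 2 * E -
      κ * (4 * π ^ 2 * B)) = 4 * π ^ 2 * (A - (B * L + E - κ * B)) by intros; ring, norm_mul,
      Real.norm_of_nonneg (by positivity : 0 ≤ 4 * π ^ 2), mul_assoc (4 * π ^ 2)]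
    gcongr
    refine h2.trans (mul_le_mul (le_abs_self _) hpow (by positivity) (abs_nonneg _))
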